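/- Let Δ be the unit simplex in ℝ^K (K ≥ 2) and let f : Δ → ℝ be continuous with f(τ₁) > 0 and f(τ₂) < 0 for some τ₁, τ₂ ∈ Δ. Then there exists a Borel probability measure η on Δ whose support is all of Δ such that ∫_Δ f dη = 0. -/

import Mathlib

open MeasureTheory Filter Topology

section RobustPerfect

variable {I : Type*} [MeasurableSpace I] {A : Type*} [Fintype A]

/-- The societal summary of a randomized strategy profile. -/
noncomputable def socSum (lam : Measure I) (h : I → A → ℝ) : A → ℝ :=
  fun a => ∫ i, h i a ∂lam

/-- `h` is a randomized strategy profile: a measurable map into the simplex. -/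
def IsProfile (lam : Measure I) (h : I → A → ℝ) : Prop :=
  Measurable h ∧ ∀ i, h i ∈ stdSimplex ℝ A

/-- A large game: payoffs continuous on the simplex and measurable in the player. -/
def IsLargeGame (u : I → A → (A → ℝ) → ℝ) : Prop :=
  (∀ i a, ContinuousOn (u i a) (stdSimplex ℝ A)) ∧
  (∀ (a : A) (τ : A → ℝ), τ ∈ stdSimplex ℝ A → Measurable fun i => u i a τ)

/-- An atomless measure. -/
def MeasAtomless (lam : Measure I) : Prop :=
  ∀ s : Set I, MeasurableSet s → 0 < lam s →
    ∃ t : Set I, MeasurableSet t ∧ t ⊆ s ∧ 0 < lam t ∧ lam t < lam s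

/-- A Borel probability measure concentrated on the simplex with full support on it. -/
def FullSupportOnSimplex (η : Measure (A → ℝ)) : Prop :=
  IsProbabilityMeasure η ∧ η (stdSimplex ℝ A)ᶜ = 0 ∧
    ∀ U : Set (A → ℝ), IsOpen U → (U ∩ stdSimplex ℝ A).Nonempty → 0 < η U

/-- A perturbation function: a Borel measurable map from the simplex to the
full-support Borel probability measures on the simplex. -/
def IsPerturbation (φ : (A → ℝ) → Measure (A → ℝ)) : Prop :=
  (∀ τ ∈ stdSimplex ℝ A, FullSupportOnSimplex (φ τ)) ∧
  ∀ f : (A → ℝ) → ℝ, Continuous f → Measurable fun τ => ∫ x, f x ∂(φ τ)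

/-- Expected payoff of action `a` against a distribution over societal summaries. -/
noncomputable def payM (ui : A → (A → ℝ) → ℝ) (a : A) (ν : Measure (A → ℝ)) : ℝ :=
  ∫ τ, ui a τ ∂ν

/-- Randomized strategy Nash equilibrium. -/
def IsNash (lam : Measure I) (u : I → A → (A → ℝ) → ℝ) (h : I → A → ℝ) : Prop :=
  IsProfile lam h ∧
  ∀ᵐ i ∂lam, ∀ μ ∈ stdSimplex ℝ A,
    ∑ a, μ a * u i a (socSum lam h) ≤ ∑ a, h i a * u i a (socSum lam h)

/-- A weakly dominated action. -/
def WeaklyDominated (ui : A → (A → ℝ) → ℝ) (a : A) : Prop :=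
  ∃ μ ∈ stdSimplex ℝ A,
    (∀ τ ∈ stdSimplex ℝ A, ui a τ ≤ ∑ b, μ b * ui b τ) ∧
    (∃ τ ∈ stdSimplex ℝ A, ui a τ < ∑ b, μ b * ui b τ)

/-- Admissibility: almost no player puts weight on a weakly dominated action. -/
def Admissible (lam : Measure I) (u : I → A → (A → ℝ) → ℝ) (h : I → A → ℝ) : Prop :=
  ∀ᵐ i ∂lam, ∀ a : A, WeaklyDominated (u i) a → h i a = 0

/-- Weak convergence of a sequence of measures to a Dirac measure. -/
def WeakTendstoDirac (ν : ℕ → Measure (A → ℝ)) (τ : A → ℝ) : Prop :=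
  ∀ f : (A → ℝ) → ℝ, Continuous f →
    Tendsto (fun n => ∫ x, f x ∂(ν n)) atTop (nhds (f τ))

/-- Aggregate robustness. -/
def AggregateRobust (lam : Measure I) (u : I → A → (A → ℝ) → ℝ) (h : I → A → ℝ) : Prop :=
  ∀ᵐ i ∂lam, ∃ φ : ℕ → (A → ℝ) → Measure (A → ℝ),
    (∀ n, IsPerturbation (φ n)) ∧
    (∀ τ ∈ stdSimplex ℝ A, WeakTendstoDirac (fun n => φ n τ) τ) ∧
    ∀ n, ∀ μ ∈ stdSimplex ℝ A,
      ∑ a, μ a * payM (u i) a (φ n (socSum lam h)) ≤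
        ∑ a, h i a * payM (u i) a (φ n (socSum lam h))

/-- `ε`-robust perfect equilibrium with perturbed player space `Iε` and
perturbation function `φ`. -/
def IsEpsRPE (lam : Measure I) (u : I → A → (A → ℝ) → ℝ) (ε : ℝ)
    (h : I → A → ℝ) (Iε : Set I) (φ : (A → ℝ) → Measure (A → ℝ)) : Prop :=
  IsProfile lam h ∧
  (∀ᵐ i ∂lam, ∀ a : A, 0 < h i a) ∧
  MeasurableSet Iε ∧ ENNReal.ofReal (1 - ε) < lam Iε ∧
  IsPerturbation φ ∧
  (∀ τ ∈ stdSimplex ℝ A, ENNReal.ofReal (1 - ε) ≤ φ τ {τ}) ∧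
  ∀ i ∈ Iε, ∀ am al : A,
    payM (u i) am (φ (socSum lam h)) < payM (u i) al (φ (socSum lam h)) →
      h i am ≤ ε

/-- Robust perfect equilibrium. -/
def IsRPE (lam : Measure I) (u : I → A → (A → ℝ) → ℝ) (h : I → A → ℝ) : Prop :=
  IsProfile lam h ∧
  ∃ (ε : ℕ → ℝ) (hs : ℕ → I → A → ℝ) (Is : ℕ → Set I)
      (φs : ℕ → (A → ℝ) → Measure (A → ℝ)),
    (∀ n, 0 < ε n) ∧ Tendsto ε atTop (nhds 0) ∧
    (∀ n, IsEpsRPE lam u (ε n) (hs n) (Is n) (φs n)) ∧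
    (∀ᵐ i ∂lam, ∃ nk : ℕ → ℕ, StrictMono nk ∧ (∀ k, i ∈ Is (nk k)) ∧
      Tendsto (fun k => hs (nk k) i) atTop (nhds (h i))) ∧
    Tendsto (fun n => socSum lam (hs n)) atTop (nhds (socSum lam h))

/-- The Dirac randomized strategy profile induced by a pure strategy profile. -/
def diracProfile [DecidableEq A] (f : I → A) : I → A → ℝ :=
  fun i a => if a = f i then 1 else 0

end RobustPerfect

/-- A nonempty simplex carries a full-support Borel probability measure: push a fully supported
probability measure on `ℕ` forward along a dense sequence. -/
theorem exists_fullSupportOnSimplex {A : Type*} [Fintype A] [Nonempty A] :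
    ∃ ν : Measure (A → ℝ), FullSupportOnSimplex ν := by
  let e : ℕ → (A → ℝ) := fun n => (TopologicalSpace.denseSeq (stdSimplex ℝ A) n : A → ℝ)
  have he : Measurable e := measurable_from_top
  refine ⟨(Measure.count : Measure ℕ).toFinite.map e, ?_, ?_, ?_⟩
  · exact Measure.isProbabilityMeasure_map he.aemeasurable
  · rw [Measure.map_apply he (isClosed_stdSimplex ℝ A).measurableSet.compl]
    convert measure_empty (μ := (Measure.count : Measure ℕ).toFinite)
    ext n
    have hn : e n ∈ stdSimplex ℝ A := (TopologicalSpace.denseSeq (stdSimplex ℝ A) n).2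
    simp [hn]
  · rintro U hU ⟨x, hxU, hx⟩
    rw [Measure.map_apply he hU.measurableSet, pos_iff_ne_zero]
    intro h0
    obtain ⟨n, hn⟩ := (TopologicalSpace.denseRange_denseSeq (stdSimplex ℝ A)).exists_mem_open
      (hU.preimage continuous_subtype_val) ⟨⟨x, hx⟩, hxU⟩
    have h1 := absolutelyContinuous_toFinite (Measure.count : Measure ℕ) h0
    rw [Measure.count_eq_zero_iff] at h1
    exact (h1 ▸ hn : n ∈ (∅ : Set ℕ))

/-- A function continuous on the simplex is integrable for every finite measure concentrated
on the simplex. -/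
theorem integrable_of_continuousOn_stdSimplex {A : Type*} [Fintype A] {ν : Measure (A → ℝ)}
    [IsFiniteMeasure ν] (hν : ν (stdSimplex ℝ A)ᶜ = 0) {f : (A → ℝ) → ℝ}
    (hf : ContinuousOn f (stdSimplex ℝ A)) : Integrable f ν := by
  have h := hf.integrableOn_compact (μ := ν) (isCompact_stdSimplex ℝ A)
  have hmem : ∀ᵐ x ∂ν, x ∈ stdSimplex ℝ A := mem_ae_iff.2 hν
  rwa [IntegrableOn, Measure.restrict_eq_self_of_ae_mem hmem] at h

/-- Mixing a full-support measure with a Dirac mass, keeping a positive weight on the former,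
preserves full support. -/
theorem FullSupportOnSimplex.add_dirac {A : Type*} [Fintype A] {ν : Measure (A → ℝ)}
    (hν : FullSupportOnSimplex ν) {τ : A → ℝ} (hτ : τ ∈ stdSimplex ℝ A) {t : ℝ}
    (h0 : 0 < t) (h1 : t ≤ 1) :
    FullSupportOnSimplex
      (ENNReal.ofReal t • ν + ENNReal.ofReal (1 - t) • Measure.dirac τ) := by
  obtain ⟨hp, hc, hU⟩ := hν
  refine ⟨⟨?_⟩, ?_, fun U hUo hUn => ?_⟩
  · simp [← ENNReal.ofReal_add h0.le (sub_nonneg.2 h1)]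
  · simp [hc, Measure.dirac_apply, hτ]
  · simpa using Or.inl ⟨h0, hU U hUo hUn⟩

/-- If the integral of `f` against a full-support measure and the value of `f` at some point of
the simplex have weakly opposite signs, then a mixture integrates `f` to zero. -/
theorem FullSupportOnSimplex.exists_integral_eq_zero {A : Type*} [Fintype A]
    {ν : Measure (A → ℝ)} (hν : FullSupportOnSimplex ν) {f : (A → ℝ) → ℝ}
    (hf : ContinuousOn f (stdSimplex ℝ A)) {τ : A → ℝ} (hτ : τ ∈ stdSimplex ℝ A)
    (hne : f τ ≠ 0) (hsign : (∫ x, f x ∂ν) * f τ ≤ 0) :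
    ∃ η : Measure (A → ℝ), FullSupportOnSimplex η ∧ ∫ x, f x ∂η = 0 := by
  set c := ∫ x, f x ∂ν with hc
  have hsq : 0 < f τ ^ 2 := by positivity
  have hd : 0 < f τ ^ 2 - c * f τ := by linarith
  set t := f τ ^ 2 / (f τ ^ 2 - c * f τ) with ht
  have h0 : 0 < t := div_pos hsq hd
  have h1 : t ≤ 1 := (div_le_one hd).2 (by linarith)
  refine ⟨_, hν.add_dirac hτ h0 h1, ?_⟩
  have := hν.1
  have hi := integrable_of_continuousOn_stdSimplex hν.2.1 hf
  have hid : Integrable f (Measure.dirac τ) := integrable_dirac (by simp)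
  rw [integral_add_measure (hi.smul_measure ENNReal.ofReal_ne_top)
    (hid.smul_measure ENNReal.ofReal_ne_top), integral_smul_measure, integral_smul_measure,
    integral_dirac, ENNReal.toReal_ofReal h0.le, ENNReal.toReal_ofReal (sub_nonneg.2 h1), ← hc,
    smul_eq_mul, smul_eq_mul, ht]
  rw [one_sub_div hd.ne', div_mul_eq_mul_div, div_mul_eq_mul_div, ← add_div,
    div_eq_zero_iff]
  exact Or.inl (by ring)

/-- If `K ≥ 2` and `f` is continuous on the unit simplex of
`ℝ^K` with `f(τ₁) > 0 > f(τ₂)` for some points `τ₁, τ₂` of the simplex, then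
there is a Borel probability measure `η` with full support on the simplex such
that `∫_Δ f dη = 0`. -/
theorem statement13 (K : ℕ) (hK : 2 ≤ K)
    (f : (Fin K → ℝ) → ℝ) (hf : ContinuousOn f (stdSimplex ℝ (Fin K)))
    (τ1 τ2 : Fin K → ℝ)
    (hτ1 : τ1 ∈ stdSimplex ℝ (Fin K)) (hτ2 : τ2 ∈ stdSimplex ℝ (Fin K))
    (hpos : 0 < f τ1) (hneg : f τ2 < 0) :
    ∃ η : Measure (Fin K → ℝ), FullSupportOnSimplex η ∧ ∫ x, f x ∂η = 0 := by
  have : Nonempty (Fin K) := ⟨⟨0, by omega⟩⟩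
  obtain ⟨ν, hν⟩ := exists_fullSupportOnSimplex (A := Fin K)
  rcases le_total 0 (∫ x, f x ∂ν) with h | h
  · exact hν.exists_integral_eq_zero hf hτ2 hneg.ne (mul_nonpos_of_nonneg_of_nonpos h hneg.le)
  · exact hν.exists_integral_eq_zero hf hτ1 hpos.ne' (mul_nonpos_of_nonpos_of_nonneg h hpos.le)
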